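/- Let R be a countable ring and let D denote the class of all flat Mittag-Leffler right R-modules. Then D^⊥ is precisely the class of all cotorsion right R-modules: a module C satisfies Ext^1_R(D, C) = 0 for all D ∈ D if and only if Ext^1_R(F, C) = 0 for every flat right R-module F. -/

import Mathlib

/-! Tensor product of a right `R`-module with a left `R`-module over a
(possibly noncommutative) ring `R`, Mittag-Leffler modules, flat right modules. -/

universe u

open scoped TensorProduct DirectSum

section NCTensor

variable (R : Type u) [Ring R] (M : Type u) [AddCommGroup M] [Module Rᵐᵒᵖ M]

/-- The subgroup of balancing relations in `M ⊗_ℤ Q`, where `M` is a right `R`-module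
and `Q` is a left `R`-module. -/
noncomputable def balancedSub (Q : Type u) [AddCommGroup Q] [Module R Q] :
    AddSubgroup (TensorProduct ℤ M Q) :=
  AddSubgroup.closure
    {x | ∃ (m : M) (r : R) (q : Q),
      x = (MulOpposite.op r • m) ⊗ₜ[ℤ] q - m ⊗ₜ[ℤ] (r • q)}

/-- The tensor product `M ⊗_R Q` of a right `R`-module `M` and a left `R`-module `Q`. -/
def NCTensor (Q : Type u) [AddCommGroup Q] [Module R Q] : Type u :=
  TensorProduct ℤ M Q ⧸ balancedSub R M Q

noncomputable instance (Q : Type u) [AddCommGroup Q] [Module R Q] : AddCommGroup (NCTensor R M Q) :=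
  inferInstanceAs (AddCommGroup (TensorProduct ℤ M Q ⧸ balancedSub R M Q))

/-- The canonical projection onto the tensor product `M ⊗_R Q`. -/
noncomputable def NCTensor.mk (Q : Type u) [AddCommGroup Q] [Module R Q] :
    TensorProduct ℤ M Q →+ NCTensor R M Q :=
  QuotientAddGroup.mk' (balancedSub R M Q)

variable {R M} in
/-- The map `M ⊗_R Q →+ M ⊗_R Q'` induced by a map of left `R`-modules `f : Q → Q'`. -/
noncomputable def NCTensor.map {Q Q' : Type u} [AddCommGroup Q] [Module R Q]
    [AddCommGroup Q'] [Module R Q'] (f : Q →ₗ[R] Q') :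
    NCTensor R M Q →+ NCTensor R M Q' :=
  QuotientAddGroup.lift (balancedSub R M Q)
    ((NCTensor.mk R M Q').comp
      (LinearMap.lTensor M f.toAddMonoidHom.toIntLinearMap).toAddMonoidHom)
    (by
      set φ := (NCTensor.mk R M Q').comp
        (LinearMap.lTensor M f.toAddMonoidHom.toIntLinearMap).toAddMonoidHom with hφ
      intro x hx
      have hle : balancedSub R M Q ≤ φ.ker := by
        rw [balancedSub]
        rw [AddSubgroup.closure_le]
        rintro _ ⟨m, r, q, rfl⟩
        have h1 : φ ((MulOpposite.op r • m) ⊗ₜ[ℤ] q - m ⊗ₜ[ℤ] (r • q)) =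
            NCTensor.mk R M Q'
              ((MulOpposite.op r • m) ⊗ₜ[ℤ] (f q) - m ⊗ₜ[ℤ] (r • f q)) := by
          simp [hφ, LinearMap.lTensor_tmul, map_sub]
        simp only [SetLike.mem_coe, AddMonoidHom.mem_ker, h1]
        exact (QuotientAddGroup.eq_zero_iff _).2
          (AddSubgroup.subset_closure ⟨m, r, f q, rfl⟩)
      exact hle hx)

variable {ι : Type u} (Q : ι → Type u) [∀ i, AddCommGroup (Q i)] [∀ i, Module R (Q i)]

/-- Auxiliary map for the Mittag-Leffler comparison map. -/
noncomputable def piCompareAux :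
    TensorProduct ℤ M (∀ i, Q i) →+ ∀ i, NCTensor R M (Q i) where
  toFun x i := NCTensor.mk R M (Q i)
    (LinearMap.lTensor M (LinearMap.proj (R := ℤ) (φ := Q) i) x)
  map_zero' := by funext i; simp
  map_add' x y := by funext i; simp [map_add]

/-- The canonical comparison map `M ⊗_R (∏ i, Q i) →+ ∏ i, (M ⊗_R Q i)`. -/
noncomputable def mlCompare : NCTensor R M (∀ i, Q i) →+ ∀ i, NCTensor R M (Q i) :=
  QuotientAddGroup.lift (balancedSub R M (∀ i, Q i)) (piCompareAux R M Q)
    (by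
      intro x hx
      have hle : balancedSub R M (∀ i, Q i) ≤ (piCompareAux R M Q).ker := by
        rw [balancedSub, AddSubgroup.closure_le]
        rintro _ ⟨m, r, q, rfl⟩
        simp only [SetLike.mem_coe, AddMonoidHom.mem_ker]
        funext i
        have h1 : piCompareAux R M Q
            ((MulOpposite.op r • m) ⊗ₜ[ℤ] q - m ⊗ₜ[ℤ] (r • q)) i =
            NCTensor.mk R M (Q i)
              ((MulOpposite.op r • m) ⊗ₜ[ℤ] (q i) - m ⊗ₜ[ℤ] (r • q i)) := by
          simp [piCompareAux, map_sub, LinearMap.lTensor_tmul]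
        rw [Pi.zero_apply, h1]
        exact (QuotientAddGroup.eq_zero_iff _).2
          (AddSubgroup.subset_closure ⟨m, r, q i, rfl⟩)
      exact hle hx)

/-- A right `R`-module `M` is Mittag-Leffler if for every family `(Q i)` of left
`R`-modules the canonical map `M ⊗_R ∏ Q i → ∏ (M ⊗_R Q i)` is injective. -/
def IsMittagLeffler : Prop :=
  ∀ (ι : Type u) (Q : ι → Type u) [∀ i, AddCommGroup (Q i)] [∀ i, Module R (Q i)],
    Function.Injective (mlCompare R M Q)

/-- A right `R`-module `M` is flat if tensoring with `M` preserves injectivity of maps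
of left `R`-modules. -/
def IsRightFlat : Prop :=
  ∀ (Q Q' : Type u) [AddCommGroup Q] [AddCommGroup Q'] [Module R Q] [Module R Q']
    (f : Q →ₗ[R] Q'), Function.Injective f →
      Function.Injective (NCTensor.map (M := M) f)

end NCTensor
section ExtGroup

open CategoryTheory

/-- The first Ext group `Ext¹_R(X, Y)` of two right `R`-modules, as a `ℤ`-module. -/
noncomputable def ext1 (R : Type u) [Ring R] (X Y : ModuleCat.{u} Rᵐᵒᵖ) : ModuleCat ℤ :=
  ((_root_.Ext ℤ (ModuleCat.{u} Rᵐᵒᵖ) 1).obj (Opposite.op X)).obj Y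

end ExtGroup


/-- Every homomorphism to `C` from the kernel of an epimorphism onto `X` extends to the domain of
that epimorphism. For modules this expresses `Ext¹(X, C) = 0`. -/
def KernelMapsExtend (S : Type u) [Ring S] (X C : Type u) [AddCommGroup X] [Module S X]
    [AddCommGroup C] [Module S C] : Prop :=
  ∀ (E : Type u) [AddCommGroup E] [Module S E] (p : E →ₗ[S] X), Function.Surjective p →
    ∀ f : LinearMap.ker p →ₗ[S] C, ∃ g : E →ₗ[S] C, ∀ x : LinearMap.ker p, g x = f x

section ExtVanishing

variable {S : Type u} [Ring S] {X C : Type u} [AddCommGroup X] [Module S X]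
  [AddCommGroup C] [Module S C]

/-- A linear map vanishing on the kernel of a surjection factors through the surjection. -/
lemma exists_factor_of_ker_le {P Q N : Type*} [AddCommGroup P] [Module S P] [AddCommGroup Q]
    [Module S Q] [AddCommGroup N] [Module S N] (p : P →ₗ[S] Q) (hp : Function.Surjective p)
    (f : P →ₗ[S] N) (h : ∀ x, p x = 0 → f x = 0) : ∃ g : Q →ₗ[S] N, ∀ x, g (p x) = f x := by
  refine ⟨((LinearMap.ker p).liftQ f h).comp
    (p.quotKerEquivOfSurjective hp).symm.toLinearMap, fun x => ?_⟩
  have : (p.quotKerEquivOfSurjective hp).symm (p x) = Submodule.Quotient.mk x := by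
    rw [LinearEquiv.symm_apply_eq]; rfl
  simp only [LinearMap.comp_apply, LinearEquiv.coe_coe, this]
  exact Submodule.liftQ_apply _ _ _

/-- It suffices to extend maps from the kernel of a single projective presentation. -/
lemma KernelMapsExtend.of_projective {P : Type u} [AddCommGroup P] [Module S P]
    [Module.Projective S P] (π : P →ₗ[S] X) (hπ : Function.Surjective π)
    (h : ∀ f : LinearMap.ker π →ₗ[S] C, ∃ g : P →ₗ[S] C, ∀ x : LinearMap.ker π, g x = f x) :
    KernelMapsExtend S X C := by
  intro E _ _ p hp f
  obtain ⟨q, hq⟩ := Module.projective_lifting_property p π hp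
  have hq' : ∀ x, p (q x) = π x := fun x => LinearMap.congr_fun hq x
  let qk : LinearMap.ker π →ₗ[S] LinearMap.ker p :=
    (q.comp (LinearMap.ker π).subtype).codRestrict _ (fun x => by simp [hq'])
  obtain ⟨g, hg⟩ := h (f.comp qk)
  let s : (LinearMap.ker p × P) →ₗ[S] E := (LinearMap.ker p).subtype.coprod q
  have hs : Function.Surjective s := by
    intro e
    obtain ⟨x, hx⟩ := hπ (p e)
    exact ⟨(⟨e - q x, by simp [hq', hx]⟩, x), by simp [s]⟩
  obtain ⟨G, hG⟩ := exists_factor_of_ker_le s hs (f.coprod g) (by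
    rintro ⟨k, x⟩ hkx
    have h0 : (k : E) + q x = 0 := by simpa [s] using hkx
    have hx : π x = 0 := by
      have := congrArg p h0
      rwa [map_add, hq', map_zero, LinearMap.mem_ker.1 k.2, zero_add] at this
    have h1 : k = - qk ⟨x, hx⟩ := by
      exact Subtype.ext (eq_neg_of_add_eq_zero_left h0)
    have h2 := hg ⟨x, hx⟩
    simp only [LinearMap.coe_comp, Function.comp_apply] at h2
    simp [h1, h2])
  refine ⟨G, fun x => ?_⟩
  simpa [s] using hG (x, 0)

open CategoryTheory

/-- Vanishing of `Ext¹` in terms of extending cocycles along a projective resolution. -/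
lemma subsingleton_ext1_iff_resolution {R : Type u} [Ring R] (X Y : ModuleCat.{u} Rᵐᵒᵖ)
    (P : ProjectiveResolution X) :
    Subsingleton (ext1 R X Y) ↔ ∀ f : P.complex.X 1 ⟶ Y, P.complex.d 2 1 ≫ f = 0 →
      ∃ g : P.complex.X 0 ⟶ Y, P.complex.d 1 0 ≫ g = f := by
  have h1 : Subsingleton (ext1 R X Y) ↔
      Limits.IsZero ((P.complex.linearYonedaObj ℤ Y).homology 1) := by
    rw [← (P.isoExt (R := ℤ) 1 Y).isZero_iff, ModuleCat.isZero_iff_subsingleton]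
    rfl
  rw [h1, ← HomologicalComplex.exactAt_iff_isZero_homology,
    HomologicalComplex.exactAt_iff' _ 0 1 2 (by simp) (by simp),
    ShortComplex.moduleCat_exact_iff]
  rfl

/-- `Ext¹(X, Y)` vanishes iff maps to `Y` from kernels of epimorphisms onto `X` extend. -/
lemma subsingleton_ext1_iff {R : Type u} [Ring R] (X Y : ModuleCat.{u} Rᵐᵒᵖ) :
    Subsingleton (ext1 R X Y) ↔ KernelMapsExtend Rᵐᵒᵖ X Y := by
  let P := projectiveResolution X
  obtain ⟨π, hπ, hex0⟩ : ∃ π : P.complex.X 0 →ₗ[Rᵐᵒᵖ] X, Function.Surjective π ∧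
      ∀ x, π x = 0 ↔ ∃ y, (P.complex.d 1 0).hom y = x := by
    refine ⟨(P.π.f 0).hom, (ModuleCat.epi_iff_surjective _).1 inferInstance, fun x =>
      ⟨fun hx => (ShortComplex.moduleCat_exact_iff _).1 P.exact₀ x hx, ?_⟩⟩
    rintro ⟨y, rfl⟩
    exact LinearMap.congr_fun (congrArg ModuleCat.Hom.hom P.complex_d_comp_π_f_zero) y
  have hex1 : ∀ x, (P.complex.d 1 0).hom x = 0 ↔ ∃ y, (P.complex.d 2 1).hom y = x := by
    refine fun x => ⟨fun hx => (ShortComplex.moduleCat_exact_iff _).1 (P.exact_succ 0) x hx, ?_⟩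
    rintro ⟨y, rfl⟩
    exact LinearMap.congr_fun (congrArg ModuleCat.Hom.hom (P.complex.d_comp_d 2 1 0)) y
  rw [subsingleton_ext1_iff_resolution X Y P]
  let d : P.complex.X 1 →ₗ[Rᵐᵒᵖ] LinearMap.ker π :=
    (P.complex.d 1 0).hom.codRestrict _ (fun x => (hex0 _).2 ⟨x, rfl⟩)
  have hd : Function.Surjective d := by
    rintro ⟨x, hx⟩
    obtain ⟨y, hy⟩ := (hex0 x).1 hx
    exact ⟨y, Subtype.ext hy⟩
  constructor
  · intro h
    have : Module.Projective Rᵐᵒᵖ (P.complex.X 0) :=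
      (IsProjective.iff_projective (P.complex.X 0)).2 (P.projective 0)
    refine KernelMapsExtend.of_projective π hπ fun f => ?_
    obtain ⟨g, hg⟩ := h (ModuleCat.ofHom (f.comp d)) (by
      ext y
      have : d ((P.complex.d 2 1).hom y) = 0 := Subtype.ext ((hex1 _).2 ⟨y, rfl⟩)
      change f (d ((P.complex.d 2 1).hom y)) = 0
      rw [this, map_zero])
    refine ⟨g.hom, fun x => ?_⟩
    obtain ⟨y, rfl⟩ := hd x
    exact LinearMap.congr_fun (congrArg ModuleCat.Hom.hom hg) y
  · intro h f hf
    obtain ⟨f', hf'⟩ := exists_factor_of_ker_le d hd f.hom (fun x hx => by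
      obtain ⟨y, rfl⟩ := (hex1 x).1 (congrArg Subtype.val hx)
      exact LinearMap.congr_fun (congrArg ModuleCat.Hom.hom hf) y)
    obtain ⟨g, hg⟩ := h _ π hπ f'
    refine ⟨ModuleCat.ofHom g, ?_⟩
    ext x
    exact (hg (d x)).trans (hf' x)

end ExtVanishing

/-- Finitely many elements of `M` can always be reconstructed from finitely many functionals. -/
def HasLocalDualBases (S : Type u) [Ring S] (M : Type u) [AddCommGroup M] [Module S M] : Prop :=
  ∀ Y : Finset M, ∃ (n : ℕ) (φ : Fin n → M →ₗ[S] S) (m : Fin n → M),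
    ∀ y ∈ Y, y = ∑ j, φ j y • m j

/-- Every linear relation in `M` is a consequence of linear relations in the base ring. -/
def RelationsAreTrivial (S : Type u) [Ring S] (M : Type u) [AddCommGroup M] [Module S M] : Prop :=
  ∀ (n : ℕ) (s : Fin n → S) (y : Fin n → M), ∑ i, s i • y i = 0 →
    ∃ (k : ℕ) (a : Fin k → Fin n → S) (z : Fin k → M),
      (∀ i, y i = ∑ j, a j i • z j) ∧ ∀ j, ∑ i, s i * a j i = 0

section Tensor

variable {R : Type u} [Ring R] {M : Type u} [AddCommGroup M] [Module Rᵐᵒᵖ M]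
  {Q : Type u} [AddCommGroup Q] [Module R Q]

lemma NCTensor.mk_surjective : Function.Surjective (NCTensor.mk R M Q) :=
  QuotientAddGroup.mk'_surjective _

lemma NCTensor.mk_eq_zero_iff (x : TensorProduct ℤ M Q) :
    NCTensor.mk R M Q x = 0 ↔ x ∈ balancedSub R M Q :=
  QuotientAddGroup.eq_zero_iff x

lemma NCTensor.mk_smul_tmul (r : R) (m : M) (q : Q) :
    NCTensor.mk R M Q ((MulOpposite.op r • m) ⊗ₜ[ℤ] q) = NCTensor.mk R M Q (m ⊗ₜ[ℤ] (r • q)) := by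
  rw [← sub_eq_zero, ← map_sub, NCTensor.mk_eq_zero_iff]
  exact AddSubgroup.subset_closure ⟨m, r, q, rfl⟩

lemma NCTensor.map_mk {Q' : Type u} [AddCommGroup Q'] [Module R Q'] (f : Q →ₗ[R] Q')
    (x : TensorProduct ℤ M Q) :
    NCTensor.map f (NCTensor.mk R M Q x) =
      NCTensor.mk R M Q' (LinearMap.lTensor M f.toAddMonoidHom.toIntLinearMap x) := rfl

lemma mlCompare_mk {ι : Type u} (Q : ι → Type u) [∀ i, AddCommGroup (Q i)] [∀ i, Module R (Q i)]
    (x : TensorProduct ℤ M (∀ i, Q i)) (i : ι) :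
    mlCompare R M Q (NCTensor.mk R M (∀ i, Q i) x) i =
      NCTensor.mk R M (Q i) (LinearMap.lTensor M (LinearMap.proj (R := ℤ) (φ := Q) i) x) := rfl

/-- The additive map on `M ⊗_R Q` induced by a balanced biadditive map. -/
noncomputable def NCTensor.lift {P : Type*} [AddCommGroup P] (f : M →+ Q →+ P)
    (hf : ∀ (r : R) m q, f (MulOpposite.op r • m) q = f m (r • q)) : NCTensor R M Q →+ P :=
  QuotientAddGroup.lift (balancedSub R M Q)
    (TensorProduct.liftAddHom f fun r m q => by simp)
    (by
      refine (AddSubgroup.closure_le _).2 ?_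
      rintro _ ⟨m, r, q, rfl⟩
      simp [AddMonoidHom.mem_ker, hf])

/-- The map `M ⊗_R Q → Q` induced by a functional on `M`. -/
noncomputable def NCTensor.evalLeft (Q : Type u) [AddCommGroup Q] [Module R Q]
    (φ : M →ₗ[Rᵐᵒᵖ] Rᵐᵒᵖ) : NCTensor R M Q →+ Q :=
  NCTensor.lift
    { toFun := fun m => DistribSMul.toAddMonoidHom Q (φ m).unop
      map_zero' := by ext; simp
      map_add' := fun m m' => by ext; simp [add_smul] }
    (fun r m q => by simp [mul_smul])

lemma NCTensor.evalLeft_mk_tmul (φ : M →ₗ[Rᵐᵒᵖ] Rᵐᵒᵖ) (m : M) (q : Q) :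
    NCTensor.evalLeft Q φ (NCTensor.mk R M Q (m ⊗ₜ[ℤ] q)) = (φ m).unop • q := rfl

/-- The map `M ⊗_R Q → M` induced by a functional on `Q`. -/
noncomputable def NCTensor.evalRight (l : Q →ₗ[R] R) : NCTensor R M Q →+ M :=
  NCTensor.lift
    { toFun := fun m => ((AddMonoidHom.flip (smulAddHom Rᵐᵒᵖ M)) m).comp
        ((MulOpposite.opAddEquiv : R ≃+ Rᵐᵒᵖ).toAddMonoidHom.comp l.toAddMonoidHom)
      map_zero' := by ext; simp
      map_add' := fun m m' => by ext; simp }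
    (fun r m q => by simp [mul_smul])

lemma NCTensor.evalRight_mk_tmul (l : Q →ₗ[R] R) (m : M) (q : Q) :
    NCTensor.evalRight l (NCTensor.mk R M Q (m ⊗ₜ[ℤ] q)) = MulOpposite.op (l q) • m := rfl

/-- If `M` has local dual bases, the functionals on `M` separate the elements of `M ⊗_R Q`. -/
lemma HasLocalDualBases.eq_zero (hM : HasLocalDualBases Rᵐᵒᵖ M) (x : NCTensor R M Q)
    (hx : ∀ φ, NCTensor.evalLeft Q φ x = 0) : x = 0 := by
  obtain ⟨x, rfl⟩ := NCTensor.mk_surjective x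
  obtain ⟨k, y, q, rfl⟩ := TensorProduct.exists_sum_tmul_eq x
  classical
  obtain ⟨n, φ, m, h⟩ := hM (Finset.univ.image y)
  have key : ∀ i, NCTensor.mk R M Q (y i ⊗ₜ[ℤ] q i) =
      ∑ j, NCTensor.mk R M Q (m j ⊗ₜ[ℤ]
        NCTensor.evalLeft Q (φ j) (NCTensor.mk R M Q (y i ⊗ₜ[ℤ] q i))) := by
    intro i
    conv_lhs => rw [h (y i) (by simp)]
    rw [TensorProduct.sum_tmul, map_sum]
    refine Finset.sum_congr rfl fun j _ => ?_
    rw [NCTensor.evalLeft_mk_tmul, ← NCTensor.mk_smul_tmul, MulOpposite.op_unop]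
  rw [map_sum, Finset.sum_congr rfl fun i _ => key i, Finset.sum_comm]
  refine Finset.sum_eq_zero fun j _ => ?_
  rw [← map_sum, ← TensorProduct.tmul_sum, ← map_sum, ← map_sum, hx, TensorProduct.tmul_zero,
    map_zero]

lemma HasLocalDualBases.isRightFlat (hM : HasLocalDualBases Rᵐᵒᵖ M) : IsRightFlat R M := by
  intro Q Q' _ _ _ _ f hf
  rw [injective_iff_map_eq_zero]
  intro x hx
  refine hM.eq_zero x fun φ => hf ?_
  have h : (NCTensor.evalLeft Q' φ).comp (NCTensor.map f) =
      f.toAddMonoidHom.comp (NCTensor.evalLeft Q φ) := by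
    ext x
    obtain ⟨x, rfl⟩ := NCTensor.mk_surjective x
    induction x with
    | zero => simp
    | add x y hx hy => simp only [map_add, hx, hy]
    | tmul m q => simp [NCTensor.map_mk, NCTensor.evalLeft_mk_tmul]
  have := DFunLike.congr_fun h x
  simpa [hx] using this.symm

lemma HasLocalDualBases.isMittagLeffler (hM : HasLocalDualBases Rᵐᵒᵖ M) :
    IsMittagLeffler R M := by
  intro ι Q _ _
  rw [injective_iff_map_eq_zero]
  intro x hx
  refine hM.eq_zero x fun φ => funext fun i => ?_
  have h : (NCTensor.evalLeft (Q i) φ).comp ((Pi.evalAddMonoidHom _ i).comp (mlCompare R M Q)) =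
      (Pi.evalAddMonoidHom _ i).comp (NCTensor.evalLeft (∀ i, Q i) φ) := by
    ext x
    obtain ⟨x, rfl⟩ := NCTensor.mk_surjective x
    induction x with
    | zero => simp
    | add x y hx hy => simp only [map_add, hx, hy]
    | tmul m q => simp [mlCompare_mk, NCTensor.evalLeft_mk_tmul]
  have := DFunLike.congr_fun h x
  simpa [hx] using this.symm

/-- Right exactness of the tensor product. -/
lemma NCTensor.mem_range_of_map_eq_zero {Q' : Type u} [AddCommGroup Q'] [Module R Q']
    (p : Q →ₗ[R] Q') (hp : Function.Surjective p) (x : NCTensor R M Q)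
    (hx : NCTensor.map p x = 0) :
    ∃ w, NCTensor.map (M := M) (LinearMap.ker p).subtype w = x := by
  obtain ⟨x, rfl⟩ := NCTensor.mk_surjective x
  rw [NCTensor.map_mk, NCTensor.mk_eq_zero_iff] at hx
  have key : balancedSub R M Q' ≤ (balancedSub R M Q).map
      (LinearMap.lTensor M p.toAddMonoidHom.toIntLinearMap).toAddMonoidHom := by
    refine (AddSubgroup.closure_le _).2 ?_
    rintro _ ⟨m, r, q, rfl⟩
    obtain ⟨q, rfl⟩ := hp q
    exact ⟨_, AddSubgroup.subset_closure ⟨m, r, q, rfl⟩, by simp⟩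
  obtain ⟨b, hb, hbx⟩ := key hx
  have hex : Function.Exact (LinearMap.ker p).subtype.toAddMonoidHom.toIntLinearMap
      p.toAddMonoidHom.toIntLinearMap := fun q => by simp
  obtain ⟨w, hw⟩ := (lTensor_exact M hex hp (x - b)).1 (by
    rw [map_sub, sub_eq_zero]; exact hbx.symm)
  refine ⟨NCTensor.mk R M _ w, ?_⟩
  rw [NCTensor.map_mk, hw, map_sub, (NCTensor.mk_eq_zero_iff b).2 hb, sub_zero]

lemma IsRightFlat.relationsAreTrivial (hM : IsRightFlat R M) : RelationsAreTrivial Rᵐᵒᵖ M := by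
  intro n s y hsy
  let g : (Fin n → R) →ₗ[R] R := Fintype.linearCombination R fun i => (s i).unop
  let x : NCTensor R M (Fin n → R) :=
    ∑ i, NCTensor.mk R M (Fin n → R) (y i ⊗ₜ[ℤ] (Pi.single i 1 : Fin n → R))
  have hx : NCTensor.map g.rangeRestrict x = 0 := by
    refine hM _ _ g.range.subtype (Submodule.injective_subtype _) ?_
    have h1 : ∀ i, NCTensor.mk R M R (y i ⊗ₜ[ℤ] g (Pi.single i 1)) =
        NCTensor.mk R M R ((s i • y i) ⊗ₜ[ℤ] 1) := fun i => by
      rw [← MulOpposite.op_unop (s i), NCTensor.mk_smul_tmul]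
      simp [g]
    simp only [x, map_sum, NCTensor.map_mk, LinearMap.lTensor_tmul, map_zero]
    calc _ = ∑ i, NCTensor.mk R M R ((s i • y i) ⊗ₜ[ℤ] 1) :=
          Finset.sum_congr rfl fun i _ => h1 i
      _ = 0 := by
        rw [← map_sum, ← TensorProduct.sum_tmul, hsy, TensorProduct.zero_tmul, map_zero]
  obtain ⟨w, hw⟩ := NCTensor.mem_range_of_map_eq_zero _ g.surjective_rangeRestrict x hx
  obtain ⟨w, rfl⟩ := NCTensor.mk_surjective w
  obtain ⟨k, z, v, rfl⟩ := TensorProduct.exists_sum_tmul_eq w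
  refine ⟨k, fun j i => MulOpposite.op ((v j : Fin n → R) i), z, fun i => ?_, fun j => ?_⟩
  · have := congrArg (NCTensor.evalRight (LinearMap.proj i)) hw
    simp only [x, map_sum, NCTensor.map_mk, LinearMap.lTensor_tmul,
      NCTensor.evalRight_mk_tmul] at this
    simpa [Pi.single_apply, ite_smul, apply_ite MulOpposite.op] using this.symm
  · have h := (v j).2
    have h' : g (v j : Fin n → R) = 0 := by
      simpa using h
    apply MulOpposite.unop_injective
    simpa [g, Fintype.linearCombination_apply] using h'

end Tensor

/-- A submodule `N` is relatively pure if every single linear equation with constant term in `N`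
that is solvable in the ambient module is solvable in `N`. -/
def Submodule.IsRelativelyPure {S M : Type u} [Ring S] [AddCommGroup M] [Module S M]
    (N : Submodule S M) : Prop :=
  ∀ (n : ℕ) (s : Fin n → S) (y : Fin n → M), ∑ i, s i • y i ∈ N →
    ∃ y' : Fin n → M, (∀ i, y' i ∈ N) ∧ ∑ i, s i • y' i = ∑ i, s i • y i

section Purity

variable {S M : Type u} [Ring S] [AddCommGroup M] [Module S M]

lemma Submodule.isRelativelyPure_bot : (⊥ : Submodule S M).IsRelativelyPure := fun _ _ _ h =>
  ⟨fun _ => 0, fun _ => Submodule.zero_mem _, by simpa using ((Submodule.mem_bot S).1 h).symm⟩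

lemma RelationsAreTrivial.quotient (hM : RelationsAreTrivial S M) {N : Submodule S M}
    (hN : N.IsRelativelyPure) : RelationsAreTrivial S (M ⧸ N) := by
  intro n s y h
  choose x hx using fun i => N.mkQ_surjective (y i)
  obtain ⟨x', hx', h'⟩ := hN n s x (by
    rw [← Submodule.Quotient.mk_eq_zero, ← Submodule.mkQ_apply]
    simpa [← hx] using h)
  obtain ⟨k, a, z, hz, ha⟩ := hM n s (fun i => x i - x' i) (by simp [smul_sub, h'])
  refine ⟨k, a, fun j => N.mkQ (z j), fun i => ?_, ha⟩
  have h0 : N.mkQ (x' i) = 0 := by simpa using hx' i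
  have := congrArg N.mkQ (hz i)
  rw [map_sub, h0, sub_zero, hx] at this
  simpa using this

lemma Submodule.IsRelativelyPure.comap_mkQ {N : Submodule S M} (hN : N.IsRelativelyPure)
    {K : Submodule S (M ⧸ N)} (hK : K.IsRelativelyPure) :
    (K.comap N.mkQ).IsRelativelyPure := by
  intro n s y h
  obtain ⟨w, hw, h1⟩ := hK n s (fun i => N.mkQ (y i)) (by simpa using h)
  choose x hx using fun i => N.mkQ_surjective (w i)
  obtain ⟨v, hv, h2⟩ := hN n s (fun i => y i - x i) (by
    rw [← Submodule.Quotient.mk_eq_zero, ← Submodule.mkQ_apply]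
    simp only [map_sum, map_smul, map_sub, hx, smul_sub, Finset.sum_sub_distrib, h1, sub_self])
  refine ⟨fun i => x i + v i, fun i => ?_, ?_⟩
  · have h0 : N.mkQ (v i) = 0 := by simpa using hv i
    rw [Submodule.mem_comap, map_add, h0, add_zero, hx]
    exact hw i
  · simp only [smul_add, Finset.sum_add_distrib, h2, smul_sub, Finset.sum_sub_distrib]
    abel

lemma Submodule.IsRelativelyPure.sSup {c : Set (Submodule S M)} (hne : c.Nonempty)
    (hdir : DirectedOn (· ≤ ·) c) (h : ∀ N ∈ c, N.IsRelativelyPure) :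
    (sSup c).IsRelativelyPure := by
  intro n s y hy
  obtain ⟨N, hN, hyN⟩ := (Submodule.mem_sSup_of_directed hne hdir).1 hy
  obtain ⟨y', hy', h'⟩ := h N hN n s y hyN
  exact ⟨y', fun i => le_sSup hN (hy' i), h'⟩

/-- Solutions of the solvable finite systems with constants in a countable submodule can be found
in a larger countable submodule. -/
lemma exists_countable_submodule_solving [Countable S] (N : Submodule S M) [Countable N] :
    ∃ N' : Submodule S M, Countable N' ∧ N ≤ N' ∧
      ∀ (n k : ℕ) (A : Fin n → Fin k → S) (y : Fin k → M), (∀ i, ∑ j, A i j • y j ∈ N) →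
        ∃ y' : Fin k → M, (∀ j, y' j ∈ N') ∧ ∀ i, ∑ j, A i j • y' j = ∑ j, A i j • y j := by
  classical
  let I := Σ n : ℕ, Σ k : ℕ, (Fin n → Fin k → S) × (Fin n → N)
  let solves (t : I) (y : Fin t.2.1 → M) : Prop := ∀ i, ∑ j, t.2.2.1 i j • y j = t.2.2.2 i
  let sol (t : I) : Fin t.2.1 → M := if h : ∃ y, solves t y then h.choose else 0
  let v : N ⊕ (Σ t : I, Fin t.2.1) → M := Sum.elim (fun x => x) fun t => sol t.1 t.2
  refine ⟨Submodule.span S (Set.range v), inferInstance, fun x hx =>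
    Submodule.subset_span ⟨Sum.inl ⟨x, hx⟩, rfl⟩, fun n k A y h => ?_⟩
  let t : I := ⟨n, k, A, fun i => ⟨_, h i⟩⟩
  have ht : ∃ y, solves t y := ⟨y, fun i => rfl⟩
  refine ⟨sol t, fun j => Submodule.subset_span ⟨Sum.inr ⟨t, j⟩, rfl⟩, ?_⟩
  have : sol t = ht.choose := dif_pos ht
  rw [this]
  exact ht.choose_spec

/-- Every element of a module over a countable ring lies in a countable pure submodule. -/
lemma exists_countable_pure_submodule [Countable S] (x : M) :
    ∃ N : Submodule S M, Countable N ∧ x ∈ N ∧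
      ∀ (n k : ℕ) (A : Fin n → Fin k → S) (y : Fin k → M), (∀ i, ∑ j, A i j • y j ∈ N) →
        ∃ y' : Fin k → M, (∀ j, y' j ∈ N) ∧ ∀ i, ∑ j, A i j • y' j = ∑ j, A i j • y j := by
  choose next hcount hle hsol using fun N : {N : Submodule S M // Countable N} =>
    haveI := N.2
    exists_countable_submodule_solving N.1
  let N₀ : {N : Submodule S M // Countable N} :=
    ⟨Submodule.span S (Set.range fun _ : Unit => x), inferInstance⟩
  let seq : ℕ → {N : Submodule S M // Countable N} := fun m =>
    Nat.rec N₀ (fun _ N => ⟨next N, hcount N⟩) m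
  have hmono : Monotone fun m => (seq m).1 := monotone_nat_of_le_succ fun m => hle (seq m)
  have hdir : Directed (· ≤ ·) fun m => (seq m).1 := hmono.directed_le
  refine ⟨⨆ m, (seq m).1, ?_, ?_, fun n k A y h => ?_⟩
  · have : ((⨆ m, (seq m).1 : Submodule S M) : Set M) = ⋃ m, ((seq m).1 : Set M) :=
      Submodule.coe_iSup_of_directed _ hdir
    refine Set.Countable.to_subtype ?_
    rw [this]
    exact Set.countable_iUnion fun m => Set.countable_coe_iff.1 (seq m).2
  · exact le_iSup (fun m => (seq m).1) 0 (Submodule.subset_span ⟨(), rfl⟩)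
  · choose m hm using fun i => (Submodule.mem_iSup_of_directed _ hdir).1 (h i)
    obtain ⟨b, hb⟩ := (Set.finite_range m).bddAbove
    obtain ⟨y', hy', hy⟩ := hsol (seq b) n k A y fun i => hmono (hb ⟨i, rfl⟩) (hm i)
    exact ⟨y', fun j => le_iSup (fun m => (seq m).1) (b + 1) (hy' j), hy⟩

lemma RelationsAreTrivial.exists_countable_submodule [Countable S]
    (hM : RelationsAreTrivial S M) (x : M) :
    ∃ N : Submodule S M, Countable N ∧ x ∈ N ∧ N.IsRelativelyPure ∧ RelationsAreTrivial S N := by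
  obtain ⟨N, hc, hx, hN⟩ := exists_countable_pure_submodule (S := S) x
  refine ⟨N, hc, hx, fun n s y h => ?_, fun n s y h => ?_⟩
  · obtain ⟨y', hy', h'⟩ := hN 1 n (fun _ => s) y fun _ => h
    exact ⟨y', hy', h' 0⟩
  · obtain ⟨k, a, z, hz, ha⟩ := hM n s (fun i => y i) (by
      simpa using congrArg N.subtype h)
    obtain ⟨z', hz', h'⟩ := hN n k (fun i j => a j i) z fun i => by
      rw [← hz]
      exact (y i).2
    refine ⟨k, a, fun j => ⟨z' j, hz' j⟩, fun i => Subtype.ext ?_, ha⟩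
    simpa [← h' i] using hz i

end Purity

section Approximation

variable {S M : Type u} [Ring S] [AddCommGroup M] [Module S M]

/-- An endomorphism of the free module on `M` that is compatible with the canonical map to `M` and
moves only finitely many basis vectors. -/
def IsFinitaryLift (θ : (M →₀ S) →ₗ[S] (M →₀ S)) : Prop :=
  (∀ x, Finsupp.linearCombination S id (θ x) = Finsupp.linearCombination S (id : M → M) x) ∧
    {i | θ (Finsupp.single i 1) ≠ Finsupp.single i 1}.Finite

lemma IsFinitaryLift.id : IsFinitaryLift (LinearMap.id : (M →₀ S) →ₗ[S] (M →₀ S)) :=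
  ⟨fun _ => rfl, by simp⟩

lemma IsFinitaryLift.comp {θ η : (M →₀ S) →ₗ[S] (M →₀ S)} (hθ : IsFinitaryLift θ)
    (hη : IsFinitaryLift η) : IsFinitaryLift (θ.comp η) := by
  refine ⟨fun x => by simp [hθ.1, hη.1], (hθ.2.union hη.2).subset fun i hi => ?_⟩
  by_contra hcon
  simp only [Set.mem_union, Set.mem_ofPred_eq, not_or, not_not] at hcon
  exact hi (by simp [hcon.1, hcon.2])

lemma RelationsAreTrivial.exists_finitaryLift_apply_eq_zero (hM : RelationsAreTrivial S M)
    (x : M →₀ S) (hx : Finsupp.linearCombination S (id : M → M) x = 0) :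
    ∃ θ : (M →₀ S) →ₗ[S] (M →₀ S), IsFinitaryLift θ ∧ θ x = 0 := by
  classical
  let e := x.support.equivFin
  have hsum {N : Type u} [AddCommGroup N] (f : M → N) :
      ∑ i, f (e.symm i) = ∑ m ∈ x.support, f m := by
    rw [e.symm.sum_comp (fun m : x.support => f m), Finset.sum_coe_sort x.support f]
  obtain ⟨k, a, z, hz, ha⟩ := hM _ (fun i => x (e.symm i)) (fun i => (e.symm i : M)) (by
    rw [hsum fun m => x m • m]
    simpa [Finsupp.linearCombination_apply, Finsupp.sum] using hx)
  let w : Fin x.support.card → (M →₀ S) := fun i => ∑ j, a j i • Finsupp.single (z j) 1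
  let v : M → (M →₀ S) := fun m => if h : m ∈ x.support then w (e ⟨m, h⟩) else Finsupp.single m 1
  have hv : ∀ i, v (e.symm i) = w i := fun i => by
    simp only [v, dif_pos (e.symm i).2, Subtype.coe_eta, Equiv.apply_symm_apply]
  have hv' : ∀ m ∉ x.support, v m = Finsupp.single m 1 := fun m h => dif_neg h
  have hvm : ∀ m, Finsupp.linearCombination S (id : M → M) (v m) = m := fun m => by
    by_cases h : m ∈ x.support
    · obtain ⟨i, hi⟩ : ∃ i, (e.symm i : M) = m := ⟨e ⟨m, h⟩, by simp⟩
      rw [← hi, hv]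
      simpa [w] using (hz i).symm
    · simp [hv' m h]
  refine ⟨Finsupp.linearCombination S v, ⟨fun y => ?_, ?_⟩, ?_⟩
  · induction y using Finsupp.induction_linear with
    | zero => simp
    | add y y' h h' => simp only [map_add, h, h']
    | single m s => simp [hvm]
  · refine x.support.finite_toSet.subset fun m hm => ?_
    by_contra h
    exact hm (by simp [hv' m h])
  · rw [Finsupp.linearCombination_apply, Finsupp.sum, ← hsum fun m => x m • v m]
    simp only [hv, w, Finset.smul_sum, smul_smul]
    rw [Finset.sum_comm]
    refine Finset.sum_eq_zero fun j _ => ?_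
    rw [← Finset.sum_smul, ha j, zero_smul]

lemma RelationsAreTrivial.exists_finitaryLift (hM : RelationsAreTrivial S M)
    (u : Finset (M →₀ S)) :
    (∀ x ∈ u, Finsupp.linearCombination S (id : M → M) x = 0) →
    ∃ θ : (M →₀ S) →ₗ[S] (M →₀ S), IsFinitaryLift θ ∧ ∀ x ∈ u, θ x = 0 := by
  classical
  induction u using Finset.induction_on with
  | empty => exact fun _ => ⟨LinearMap.id, IsFinitaryLift.id, by simp⟩
  | insert x u _ ih =>
    intro hu
    obtain ⟨θ, hθ, h⟩ := ih fun y hy => hu y (Finset.mem_insert_of_mem hy)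
    obtain ⟨η, hη, h'⟩ := hM.exists_finitaryLift_apply_eq_zero (θ x) (by
      rw [hθ.1]
      exact hu x (Finset.mem_insert_self _ _))
    refine ⟨η.comp θ, hη.comp hθ, fun y hy => ?_⟩
    rcases Finset.mem_insert.1 hy with rfl | hy
    · exact h'
    · simp [h y hy]

/-- A countable flat module is the colimit of a sequence of endomorphisms `θ (n + 1)` of a free
module, normalised so that `θ m ∘ θ n = θ m` for `n < m`. -/
lemma RelationsAreTrivial.exists_approximation [Countable S] [Countable M]
    (hM : RelationsAreTrivial S M) :
    ∃ θ : ℕ → (M →₀ S) →ₗ[S] (M →₀ S),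
      (∀ n x, Finsupp.linearCombination S id (θ n x) =
        Finsupp.linearCombination S (id : M → M) x) ∧
      (∀ m n, n < m → ∀ x, θ m (θ n x) = θ m x) ∧
      ∀ x, Finsupp.linearCombination S (id : M → M) x = 0 → ∃ n, ∀ m, n ≤ m → θ m x = 0 := by
  classical
  obtain ⟨κ, hκ⟩ := exists_surjective_nat
    (LinearMap.ker (Finsupp.linearCombination S (id : M → M)))
  have step (n : ℕ) (θ : {θ : (M →₀ S) →ₗ[S] (M →₀ S) // IsFinitaryLift θ}) :
      ∃ η : {θ : (M →₀ S) →ₗ[S] (M →₀ S) // IsFinitaryLift θ},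
        (∀ x, η.1 (θ.1 x) = η.1 x) ∧ ∀ i ≤ n, η.1 (κ i) = 0 := by
    obtain ⟨θ, hθ⟩ := θ
    obtain ⟨η, hη, h⟩ := hM.exists_finitaryLift
      ((Finset.range (n + 1)).image (fun i => (κ i : M →₀ S)) ∪
        hθ.2.toFinset.image fun i => θ (Finsupp.single i 1) - Finsupp.single i 1) (by
      intro x hx
      rcases Finset.mem_union.1 hx with hx | hx <;> obtain ⟨i, _, rfl⟩ := Finset.mem_image.1 hx
      · exact (κ i).2
      · rw [map_sub, hθ.1, sub_self])
    refine ⟨⟨η, hη⟩, fun x => ?_, fun i hi => h _ (Finset.mem_union_left _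
      (Finset.mem_image_of_mem _ (Finset.mem_range_succ_iff.2 hi)))⟩
    have hcomp : η.comp θ = η := by
      refine Finsupp.lhom_ext' fun i => LinearMap.ext_ring ?_
      by_cases hi : θ (Finsupp.single i 1) = Finsupp.single i 1
      · simp [hi]
      · have := h (θ (Finsupp.single i 1) - Finsupp.single i 1) (Finset.mem_union_right _
          (Finset.mem_image_of_mem _ (hθ.2.mem_toFinset.2 hi)))
        simpa [sub_eq_zero] using this
    exact LinearMap.congr_fun hcomp x
  choose next hnext hkill using step
  let θ : ℕ → {θ : (M →₀ S) →ₗ[S] (M →₀ S) // IsFinitaryLift θ} := fun m =>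
    Nat.rec ⟨LinearMap.id, IsFinitaryLift.id⟩ next m
  have hsucc : ∀ n x, (θ (n + 1)).1 ((θ n).1 x) = (θ (n + 1)).1 x := fun n => hnext n (θ n)
  refine ⟨fun n => (θ n).1, fun n => (θ n).2.1, fun m n hnm x => ?_, fun x hx => ?_⟩
  · induction m, hnm using Nat.le_induction with
    | base => exact hsucc n x
    | succ m hm ih =>
      change (θ (m + 1)).1 _ = (θ (m + 1)).1 _
      rw [← hsucc m, ih, hsucc m]
  · obtain ⟨i, hi⟩ := hκ ⟨x, hx⟩
    refine ⟨i + 1, fun m hm => ?_⟩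
    obtain ⟨m, rfl⟩ : ∃ k, m = k + 1 := ⟨m - 1, by omega⟩
    have := hkill m (θ m) i (by omega)
    rwa [hi] at this

end Approximation

section BranchCounting

/-- For every `C` there is an infinite type `κ` with `#C ≤ #κ` and `2 ^ #κ ≤ #κ ^ ℵ₀`. -/
lemma exists_type_set_embedding_sequences (C : Type u) :
    ∃ κ : Type u, Infinite κ ∧ Nonempty (C ↪ κ) ∧ Nonempty (Set κ ↪ (ℕ → κ)) := by
  let X : ℕ → Type u := fun n => Nat.rec (C ⊕ ULift.{u} ℕ) (fun _ X => Set X) n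
  refine ⟨Σ n, X n, ?_, ⟨⟨fun c => ⟨0, Sum.inl c⟩, fun c c' h => ?_⟩⟩,
    ⟨⟨fun s n => ⟨n + 1, {x : X n | (⟨n, x⟩ : Σ n, X n) ∈ s}⟩, fun s s' h => ?_⟩⟩⟩
  · refine Infinite.of_injective (fun n : ℕ => (⟨0, Sum.inr ⟨n⟩⟩ : Σ n, X n)) fun n n' h => ?_
    have h' : (Sum.inr ⟨n⟩ : C ⊕ ULift.{u} ℕ) = Sum.inr ⟨n'⟩ := eq_of_heq (Sigma.mk.inj h).2
    simpa using h'
  · have h' : (Sum.inl c : C ⊕ ULift.{u} ℕ) = Sum.inl c' := eq_of_heq (Sigma.mk.inj h).2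
    simpa using h'
  · ext ⟨n, x⟩
    have h' : ({x : X n | (⟨n, x⟩ : Σ n, X n) ∈ s} : Set (X n)) =
        {x : X n | (⟨n, x⟩ : Σ n, X n) ∈ s'} := eq_of_heq (Sigma.mk.inj (congrFun h n)).2
    exact Set.ext_iff.1 h' x

/-- There is a tree with few nodes and many branches, measured against `C`. -/
lemma exists_branching (C L : Type u) [Countable L] :
    ∃ (A B : Type u) (r : B → ℕ → A),
      (∀ b b', b ≠ b' → ∀ᶠ n in Filter.atTop, r b n ≠ r b' n) ∧
      ∀ F : Set B → ((ℕ × A) × L → C), ¬ Function.Injective F := by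
  obtain ⟨κ, _, ⟨hC⟩, ⟨hκ⟩⟩ := exists_type_set_embedding_sequences C
  refine ⟨List κ, ℕ → κ, fun b n => (List.range n).map b, fun b b' hb => ?_, fun F hF => ?_⟩
  · obtain ⟨k, hk⟩ := Function.ne_iff.1 hb
    filter_upwards [Filter.eventually_gt_atTop k] with n hn h
    exact hk (List.map_inj_left.1 h k (List.mem_range.2 hn))
  · have hinf : Cardinal.aleph0 ≤ Cardinal.mk κ := Cardinal.aleph0_le_mk κ
    have hT : Cardinal.mk ((ℕ × List κ) × L) ≤ Cardinal.mk κ := by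
      have hL : Cardinal.mk L ≤ Cardinal.mk κ := (Cardinal.mk_le_aleph0 (α := L)).trans hinf
      rw [Cardinal.mk_prod, Cardinal.mk_prod, Cardinal.mk_list_eq_mk]
      simp only [Cardinal.lift_id, Cardinal.mk_nat, Cardinal.lift_aleph0, Cardinal.lift_uzero]
      rw [Cardinal.aleph0_mul_eq hinf]
      exact (mul_le_mul_right hL _).trans (Cardinal.mul_eq_self hinf).le
    have h1 : Cardinal.mk (((ℕ × List κ) × L) → C) ≤ Cardinal.mk (ℕ → κ) := by
      calc Cardinal.mk (((ℕ × List κ) × L) → C)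
          ≤ Cardinal.mk (((ℕ × List κ) × L) → κ) := Cardinal.mk_le_of_injective
            (f := fun g t => hC (g t)) fun g g' h => funext fun t => hC.injective (congrFun h t)
        _ = Cardinal.mk κ ^ Cardinal.mk ((ℕ × List κ) × L) := by simp
        _ ≤ Cardinal.mk κ ^ Cardinal.mk κ :=
            Cardinal.power_le_power_left (Cardinal.mk_ne_zero κ) hT
        _ = 2 ^ Cardinal.mk κ := Cardinal.power_self_eq hinf
        _ = Cardinal.mk (Set κ) := Cardinal.mk_set.symm
        _ ≤ Cardinal.mk (ℕ → κ) := Cardinal.mk_le_of_injective hκ.injective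
    have h2 := (Cardinal.mk_le_of_injective hF).trans h1
    rw [Cardinal.mk_set] at h2
    exact (Cardinal.cantor _).not_ge h2

end BranchCounting

section LocalDualBases

variable {S M : Type u} [Ring S] [AddCommGroup M] [Module S M]

/-- Reconstructing finite subsets of `M` through finitely many maps to a free module yields local
dual bases. -/
lemma HasLocalDualBases.of_free {ι : Type u}
    (h : ∀ Y : Finset M, ∃ (J : Type*) (_ : Fintype J) (p : J → M →ₗ[S] (ι →₀ S))
      (α : J → (ι →₀ S) →ₗ[S] M), ∀ y ∈ Y, y = ∑ j, α j (p j y)) :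
    HasLocalDualBases S M := by
  classical
  intro Y
  obtain ⟨J, _, p, α, hY⟩ := h Y
  let I : Finset ι := Y.biUnion fun y => Finset.univ.biUnion fun j => (p j y).support
  let e := Fintype.equivFin (J × I)
  refine ⟨Fintype.card (J × I), fun k => (Finsupp.lapply ((e.symm k).2 : ι)).comp (p (e.symm k).1),
    fun k => α (e.symm k).1 (Finsupp.single ((e.symm k).2 : ι) 1), fun y hy => ?_⟩
  have hI : ∀ j, (p j y).support ⊆ I := fun j i hi => Finset.mem_biUnion.2
    ⟨y, hy, Finset.mem_biUnion.2 ⟨j, Finset.mem_univ _, hi⟩⟩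
  rw [e.symm.sum_comp fun t : J × I => (Finsupp.lapply (t.2 : ι)).comp (p t.1) y •
    α t.1 (Finsupp.single (t.2 : ι) 1), Fintype.sum_prod_type]
  conv_lhs => rw [hY y hy]
  refine Finset.sum_congr rfl fun j _ => ?_
  have hp : p j y = ∑ i ∈ I, p j y i • Finsupp.single i (1 : S) := by
    conv_lhs => rw [← Finsupp.sum_single (p j y)]
    rw [Finsupp.sum_of_support_subset _ (hI j) _ (by simp)]
    simp
  conv_lhs => rw [hp, map_sum, ← Finset.sum_coe_sort]
  refine Finset.sum_congr rfl fun i _ => ?_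
  rw [map_smul]
  rfl

end LocalDualBases

section BranchModule

variable {S L A B : Type u} [Ring S] [AddCommGroup L] [Module S L]

open Classical in
/-- The function on nodes that takes the values `θ n x` along the branch `b`. -/
noncomputable def alongBranch (θ : ℕ → L →ₗ[S] L) (r : B → ℕ → A) (b : B) :
    L →ₗ[S] (ℕ × A → L) :=
  LinearMap.pi fun t => if t.2 = r b t.1 then θ t.1 else 0

/-- The module of functions on nodes generated by the finitely supported functions and the
functions along branches is the range of this map. -/
noncomputable def branchMap (θ : ℕ → L →ₗ[S] L) (r : B → ℕ → A) :
    ((ℕ × A →₀ L) × (B →₀ L)) →ₗ[S] (ℕ × A → L) :=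
  Finsupp.lcoeFun.coprod (Finsupp.lsum ℕ (alongBranch θ r))

variable (θ : ℕ → L →ₗ[S] L) (r : B → ℕ → A)

open Classical in
lemma branchMap_apply (p : (ℕ × A →₀ L) × (B →₀ L)) (U : Finset B) (hU : p.2.support ⊆ U)
    (t : ℕ × A) : branchMap θ r p t =
      p.1 t + ∑ b ∈ U, if t.2 = r b t.1 then θ t.1 (p.2 b) else 0 := by
  have h : branchMap θ r p = p.1 + ∑ b ∈ U, alongBranch θ r b (p.2 b) := by
    simp only [branchMap, LinearMap.coprod_apply, Finsupp.coe_lsum]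
    rw [Finsupp.sum_of_support_subset _ hU _ (by simp)]
    rfl
  rw [h, Pi.add_apply, Finset.sum_apply]
  congr 1
  refine Finset.sum_congr rfl fun b _ => ?_
  simp only [alongBranch, LinearMap.pi_apply]
  split_ifs <;> rfl

lemma eventually_finsupp_level_eq_zero (g : ℕ × A →₀ L) :
    ∀ᶠ n in Filter.atTop, ∀ m a, n ≤ m → g (m, a) = 0 := by
  filter_upwards [(Filter.eventually_all_finset g.support).2 fun t _ =>
    Filter.eventually_gt_atTop t.1] with n hn m a hm
  by_contra h
  exact absurd (hn (m, a) (Finsupp.mem_support_iff.2 h)) hm.not_gt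

lemma eventually_branchMap_apply
    (hr : ∀ b b', b ≠ b' → ∀ᶠ n in Filter.atTop, r b n ≠ r b' n)
    (p : (ℕ × A →₀ L) × (B →₀ L)) (b : B) :
    ∀ᶠ n in Filter.atTop, branchMap θ r p (n, r b n) = θ n (p.2 b) := by
  classical
  have h : ∀ b' ∈ p.2.support, ∀ᶠ n in Filter.atTop, b ≠ b' → r b n ≠ r b' n := fun b' _ => by
    by_cases hb : b = b'
    · simp [hb]
    · simpa [hb] using hr b b' hb
  filter_upwards [eventually_finsupp_level_eq_zero p.1,
    (Filter.eventually_all_finset p.2.support).2 h] with n hn hb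
  rw [branchMap_apply θ r p _ subset_rfl, hn n _ le_rfl, zero_add, Finset.sum_eq_single b]
  · simp
  · exact fun b' hb' hne => if_neg (hb b' hb' hne.symm)
  · intro hb
    simp [Finsupp.notMem_support_iff.1 hb]

/-- The initial segment below level `n` of the function along the branch `b`. -/
noncomputable def initialSegment (b : B) (n : ℕ) : L →ₗ[S] (ℕ × A →₀ L) :=
  ∑ m ∈ Finset.range n, (Finsupp.lsingle (m, r b m)).comp (θ m)

open Classical in
lemma initialSegment_apply (b : B) (n : ℕ) (x : L) (t : ℕ × A) :
    initialSegment θ r b n x t = if t.1 < n ∧ t.2 = r b t.1 then θ t.1 x else 0 := by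
  obtain ⟨k, a⟩ := t
  simp only [initialSegment, LinearMap.sum_apply, LinearMap.comp_apply, Finsupp.lsingle_apply,
    Finsupp.finsetSum_apply, Finsupp.single_apply, Prod.mk.injEq]
  split_ifs with h
  · rw [Finset.sum_eq_single k]
    · simp [h.2]
    · exact fun m _ hm => if_neg fun h' => hm h'.1
    · exact fun hk => absurd (Finset.mem_range.2 h.1) hk
  · refine Finset.sum_eq_zero fun m hm => if_neg ?_
    rintro ⟨rfl, rfl⟩
    exact h ⟨Finset.mem_range.1 hm, rfl⟩

lemma exists_branchMap_eq_zero (b : B) (x : L) (hx : ∃ n, ∀ m, n ≤ m → θ m x = 0) :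
    ∃ g, branchMap θ r (g, Finsupp.single b x) = 0 := by
  classical
  obtain ⟨n, hn⟩ := hx
  refine ⟨-initialSegment θ r b n x, funext fun t => ?_⟩
  rw [branchMap_apply θ r _ {b} Finsupp.support_single_subset]
  simp only [Finsupp.neg_apply, initialSegment_apply, Finset.sum_singleton,
    Finsupp.single_eq_same, Pi.zero_apply]
  by_cases h : t.1 < n
  · simp [h]
  · simp [h, hn t.1 (not_lt.1 h)]

lemma hasLocalDualBases_range_branchMap {ι : Type u} (θ : ℕ → (ι →₀ S) →ₗ[S] (ι →₀ S))
    (hθ : ∀ m n, n < m → ∀ x, θ m (θ n x) = θ m x)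
    (hr : ∀ b b', b ≠ b' → ∀ᶠ n in Filter.atTop, r b n ≠ r b' n) :
    HasLocalDualBases S (LinearMap.range (branchMap θ r)) := by
  classical
  refine HasLocalDualBases.of_free (ι := ι) fun Y => ?_
  choose p hp using fun y : LinearMap.range (branchMap θ r) => y.2
  let U : Finset B := Y.biUnion fun y => (p y).2.support
  obtain ⟨n, hn1, hn2⟩ := (((Filter.eventually_all_finset Y).2 fun y _ =>
    eventually_finsupp_level_eq_zero (p y).1).and ((Filter.eventually_all_finset Y).2 fun y _ =>
      (Filter.eventually_all_finset U).2 fun b _ =>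
        eventually_branchMap_apply θ r hr (p y) b)).exists
  let T : Finset (ℕ × A) := ((Y.biUnion fun y => (p y).1.support) ∪
    (U ×ˢ Finset.range (n + 1)).image fun t => (t.2, r t.1 t.2)).filter fun t => t.1 ≤ n
  let ev (t : ℕ × A) : LinearMap.range (branchMap θ r) →ₗ[S] (ι →₀ S) :=
    (LinearMap.proj t).comp (Submodule.subtype _)
  let Φ := (branchMap θ r).rangeRestrict
  refine ⟨T ⊕ U, inferInstance,
    Sum.elim (fun t => ev t) (fun b => ev (n, r b n)),
    Sum.elim (fun t => Φ.comp ((LinearMap.inl S _ _).comp (Finsupp.lsingle (t : ℕ × A))))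
      (fun b => Φ.comp ((-initialSegment θ r (b : B) (n + 1)).prod
        (Finsupp.lsingle (b : B)))), fun y hy => ?_⟩
  have hyU : (p y).2.support ⊆ U := fun b hb => Finset.mem_biUnion.2 ⟨y, hy, hb⟩
  have hyt : ∀ t, (y : ℕ × A → ι →₀ S) t =
      (p y).1 t + ∑ b ∈ U, if t.2 = r b t.1 then θ t.1 ((p y).2 b) else 0 := fun t => by
    rw [← branchMap_apply θ r (p y) U hyU t, hp]
  have hyn : ∀ b ∈ U, (y : ℕ × A → ι →₀ S) (n, r b n) = θ n ((p y).2 b) := fun b hb => by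
    rw [← hn2 y hy b hb, hp]
  have hinit : ∀ b z t, branchMap θ r (-initialSegment θ r b (n + 1) z, Finsupp.single b z) t =
      if t.2 = r b t.1 ∧ n < t.1 then θ t.1 z else 0 := fun b z t => by
    rw [branchMap_apply θ r _ {b} Finsupp.support_single_subset]
    simp only [Finsupp.neg_apply, initialSegment_apply, Finset.sum_singleton,
      Finsupp.single_eq_same]
    by_cases h : t.1 < n + 1
    · simp [h, show ¬ n < t.1 by omega]
    · simp [h, show n < t.1 by omega]
  have hsingle : ∀ t z, branchMap θ r (Finsupp.single t z, 0) = Finsupp.single t z := fun t z => by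
    simp [branchMap]
  have hT : ∀ t ∉ T, t.1 ≤ n → (y : ℕ × A → ι →₀ S) t = 0 := fun t ht hle => by
    simp only [T, Finset.mem_filter, hle, and_true, Finset.mem_union, not_or] at ht
    rw [hyt, Finsupp.notMem_support_iff.1 fun h => ht.1 (Finset.mem_biUnion.2 ⟨y, hy, h⟩), zero_add]
    refine Finset.sum_eq_zero fun b hb => if_neg fun h => ht.2 (Finset.mem_image.2
      ⟨(b, t.1), Finset.mem_product.2 ⟨hb, Finset.mem_range_succ_iff.2 hle⟩, ?_⟩)
    rw [← h]
  have hkey : (y : ℕ × A → ι →₀ S) = (∑ t ∈ T, branchMap θ r (Finsupp.single t (y.1 t), 0)) +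
      ∑ b ∈ U, branchMap θ r (-initialSegment θ r b (n + 1) (y.1 (n, r b n)),
        Finsupp.single b (y.1 (n, r b n))) := by
    funext t
    simp only [Pi.add_apply, Finset.sum_apply, hinit, hsingle, Finsupp.single_apply,
      Finset.sum_ite_eq']
    by_cases hle : t.1 ≤ n
    · simp only [hle.not_gt, and_false, if_false, Finset.sum_const_zero, add_zero]
      split_ifs with h
      · rfl
      · exact hT t h hle
    · have htT : t ∉ T := fun h => hle (Finset.mem_filter.1 h).2
      rw [if_neg htT, zero_add, hyt, hn1 y hy t.1 t.2 (not_le.1 hle).le, zero_add]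
      refine Finset.sum_congr rfl fun b hb => ?_
      rw [hyn b hb, hθ _ _ (not_le.1 hle)]
      simp [not_le.1 hle]
  rw [Fintype.sum_sum_type]
  refine Subtype.ext (hkey.trans ?_)
  rw [← Finset.sum_coe_sort T, ← Finset.sum_coe_sort U]
  simp [ev, Φ]

end BranchModule

section Counting

variable {S : Type u} [Ring S]

/-- A linear map to finitely supported functions with values in a submodule, with restricted
codomain. -/
noncomputable def finsuppCodRestrict {L X B : Type*} [AddCommGroup L] [Module S L]
    [AddCommGroup X] [Module S X] (N : Submodule S L) (φ : X →ₗ[S] (B →₀ L))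
    (h : ∀ x b, φ x b ∈ N) : X →ₗ[S] (B →₀ N) where
  toFun x := Finsupp.onFinset (φ x).support (fun b => ⟨φ x b, h x b⟩) (fun b hb =>
    Finsupp.mem_support_iff.2 fun h0 => hb (Subtype.ext h0))
  map_add' x y := by ext b; simp
  map_smul' s x := by ext b; simp

/-- A module `C` which is `Ext¹`-orthogonal to all modules with local dual bases is
`Ext¹`-orthogonal to all countable modules with trivial relations. -/
lemma kernelMapsExtend_of_countable [Countable S] {C : Type u} [AddCommGroup C] [Module S C]
    (hC : ∀ (D : Type u) [AddCommGroup D] [Module S D], HasLocalDualBases S D →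
      KernelMapsExtend S D C)
    {M : Type u} [AddCommGroup M] [Module S M] [Countable M] (hM : RelationsAreTrivial S M) :
    KernelMapsExtend S M C := by
  classical
  obtain ⟨θ, hθπ, hθ, hθ0⟩ := hM.exists_approximation
  obtain ⟨A, B, r, hr, hF⟩ := exists_branching C (M →₀ S)
  let π : (M →₀ S) →ₗ[S] M := Finsupp.linearCombination S id
  refine KernelMapsExtend.of_projective π
    (fun m => ⟨Finsupp.single m 1, by simp [π]⟩) fun f => ?_
  let Φ := (branchMap θ r).rangeRestrict
  let snd : LinearMap.ker Φ →ₗ[S] (B →₀ (M →₀ S)) :=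
    (LinearMap.snd S _ _).comp (LinearMap.ker Φ).subtype
  have hsnd : ∀ p b, snd p b ∈ LinearMap.ker π := fun p b => by
    obtain ⟨n, hn⟩ := (eventually_branchMap_apply θ r hr p.1 b).exists
    have h0 : branchMap θ r p.1 = 0 := congrArg Subtype.val p.2
    have h1 : θ n (snd p b) = 0 := by
      rw [h0] at hn
      exact hn.symm
    change π (snd p b) = 0
    rw [← hθπ n, h1, map_zero]
  choose h hh using fun s : Set B => hC _ (hasLocalDualBases_range_branchMap r θ hθ hr) _ Φ
    (branchMap θ r).surjective_rangeRestrict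
    ((Finsupp.lsum ℕ fun b => if b ∈ s then f else 0).comp
      (finsuppCodRestrict (LinearMap.ker π) snd hsnd))
  have hval : ∀ (s : Set B) b (x : M →₀ S) (hx : x ∈ LinearMap.ker π) g,
      branchMap θ r (g, Finsupp.single b x) = 0 →
      h s (g, Finsupp.single b x) = if b ∈ s then f ⟨x, hx⟩ else 0 := by
    intro s b x hx g hg
    have hk : finsuppCodRestrict (LinearMap.ker π) snd hsnd
        ⟨(g, Finsupp.single b x), Subtype.ext hg⟩ = Finsupp.single b ⟨x, hx⟩ := by
      ext1 b'
      refine Subtype.ext ?_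
      change Finsupp.single b x b' = _
      rw [Finsupp.single_apply, Finsupp.single_apply]
      split_ifs <;> rfl
    refine (hh s ⟨(g, Finsupp.single b x), Subtype.ext hg⟩).trans ?_
    rw [LinearMap.comp_apply, hk, Finsupp.lsum_single]
    split_ifs <;> rfl
  obtain ⟨s, s', heq, hne⟩ : ∃ s s' : Set B,
      (∀ t l, h s (Finsupp.single t l, 0) = h s' (Finsupp.single t l, 0)) ∧ s ≠ s' := by
    have := hF fun s q => h s (Finsupp.single q.1 q.2, 0)
    simp only [Function.Injective, not_forall] at this
    obtain ⟨s, s', h1, h2⟩ := this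
    exact ⟨s, s', fun t l => congrFun h1 (t, l), h2⟩
  obtain ⟨s, s', b, hb, hb', heq⟩ : ∃ (s s' : Set B) (b : B), b ∈ s ∧ b ∉ s' ∧
      ∀ t l, h s (Finsupp.single t l, 0) = h s' (Finsupp.single t l, 0) := by
    by_cases hss : s ⊆ s'
    · obtain ⟨b, hb, hb'⟩ := Set.not_subset.1 fun hs => hne (hss.antisymm hs)
      exact ⟨s', s, b, hb, hb', fun t l => (heq t l).symm⟩
    · obtain ⟨b, hb, hb'⟩ := Set.not_subset.1 hss
      exact ⟨s, s', b, hb, hb', heq⟩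
  have hinl : (h s).comp (LinearMap.inl S _ _) = (h s').comp (LinearMap.inl S _ _) :=
    Finsupp.lhom_ext heq
  refine ⟨(h s - h s').comp ((LinearMap.inr S _ _).comp (Finsupp.lsingle b)), fun x => ?_⟩
  obtain ⟨g, hg⟩ := exists_branchMap_eq_zero θ r b (x : M →₀ S) (hθ0 x x.2)
  have hsplit : ((0, Finsupp.single b (x : M →₀ S)) : (ℕ × A →₀ (M →₀ S)) × (B →₀ (M →₀ S))) =
      (g, Finsupp.single b (x : M →₀ S)) - (g, 0) :=
    Prod.ext (sub_self g).symm (sub_zero (Finsupp.single b (x : M →₀ S))).symm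
  have h1 : h s (g, 0) = h s' (g, 0) := LinearMap.congr_fun hinl g
  change h s (0, Finsupp.single b (x : M →₀ S)) - h s' (0, Finsupp.single b (x : M →₀ S)) = f x
  rw [hsplit, map_sub, map_sub, hval s b x x.2 g hg, hval s' b x x.2 g hg, if_pos hb, if_neg hb',
    h1]
  simp

end Counting

section Filtration

variable {S : Type u} [Ring S]

/-- A map on the preimage of `N` extends to the preimage of a larger submodule `K` when the
relevant extension problem for the subquotient `K / N` is solvable. -/
lemma exists_extension_comap {E F C : Type u} [AddCommGroup E] [Module S E] [AddCommGroup F]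
    [Module S F] [AddCommGroup C] [Module S C] {p : E →ₗ[S] F} (hp : Function.Surjective p)
    (N : Submodule S F) (K : Submodule S (F ⧸ N)) (hK : KernelMapsExtend S K C)
    (g : N.comap p →ₗ[S] C) :
    ∃ g' : (K.comap N.mkQ).comap p →ₗ[S] C, ∀ (x : E) (hx : x ∈ N.comap p)
      (hx' : x ∈ (K.comap N.mkQ).comap p), g' ⟨x, hx'⟩ = g ⟨x, hx⟩ := by
  let q : (K.comap N.mkQ).comap p →ₗ[S] K :=
    ((N.mkQ.comp p).comp (Submodule.subtype _)).codRestrict K fun x => x.2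
  have hq : Function.Surjective q := by
    rintro ⟨k, hk⟩
    obtain ⟨y, rfl⟩ := N.mkQ_surjective k
    obtain ⟨x, rfl⟩ := hp y
    exact ⟨⟨x, hk⟩, rfl⟩
  have hker : ∀ x, q x = 0 → (x : E) ∈ N.comap p := fun x hx =>
    (Submodule.Quotient.mk_eq_zero N).1 (congrArg Subtype.val hx)
  let j : LinearMap.ker q →ₗ[S] N.comap p :=
    ((Submodule.subtype _).comp (Submodule.subtype _)).codRestrict _ fun x => hker x.1 x.2
  obtain ⟨g', hg'⟩ := hK _ q hq (g.comp j)
  refine ⟨g', fun x hx hx' => hg' ⟨⟨x, hx'⟩, Subtype.ext ?_⟩⟩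
  exact (Submodule.Quotient.mk_eq_zero N).2 hx

/-- Extension problems for a module with trivial relations over a countable ring can be solved
along a filtration by countable modules with trivial relations. -/
lemma RelationsAreTrivial.kernelMapsExtend [Countable S] {F C : Type u} [AddCommGroup F]
    [Module S F] [AddCommGroup C] [Module S C] (hF : RelationsAreTrivial S F)
    (hC : ∀ (N : Type u) [AddCommGroup N] [Module S N] [Countable N], RelationsAreTrivial S N →
      KernelMapsExtend S N C) :
    KernelMapsExtend S F C := by
  intro E _ _ p hp f
  let f₀ : E →ₗ.[S] C := ⟨LinearMap.ker p, f⟩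
  let good : Set (E →ₗ.[S] C) :=
    {φ | f₀ ≤ φ ∧ ∃ N : Submodule S F, N.IsRelativelyPure ∧ φ.domain = N.comap p}
  have hf₀ : f₀ ∈ good := ⟨le_rfl, ⊥, Submodule.isRelativelyPure_bot, rfl⟩
  obtain ⟨φ, hle, hφ⟩ := zorn_le_nonempty₀ good (fun c hc hchain φ₀ hφ₀ => by
    have hdir := hchain.directedOn
    refine ⟨LinearPMap.sSup c hdir,
      ⟨(hc hφ₀).1.trans (LinearPMap.le_sSup hdir hφ₀), ?_⟩, fun φ hφ => LinearPMap.le_sSup hdir hφ⟩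
    let c' : Set (Submodule S F) := (fun φ : E →ₗ.[S] C => φ.domain.map p) '' c
    have hmap : ∀ φ ∈ c, (φ.domain.map p).IsRelativelyPure ∧
        (φ.domain.map p).comap p = φ.domain := fun φ hφ => by
      obtain ⟨N, hN, h⟩ := (hc hφ).2
      rw [h, Submodule.map_comap_eq_of_surjective hp]
      exact ⟨hN, rfl⟩
    have hc'ne : c'.Nonempty := ⟨_, φ₀, hφ₀, rfl⟩
    have hc'dir : DirectedOn (· ≤ ·) c' := by
      rintro _ ⟨φ, hφ, rfl⟩ _ ⟨ψ, hψ, rfl⟩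
      obtain ⟨χ, hχ, h1, h2⟩ := hdir φ hφ ψ hψ
      exact ⟨_, ⟨χ, hχ, rfl⟩, Submodule.map_mono h1.1, Submodule.map_mono h2.1⟩
    refine ⟨sSup c', Submodule.IsRelativelyPure.sSup hc'ne hc'dir ?_, ?_⟩
    · rintro _ ⟨φ, hφ, rfl⟩
      exact (hmap φ hφ).1
    · change sSup (LinearPMap.domain '' c) = _
      refine le_antisymm (sSup_le ?_) fun x hx => ?_
      · rintro _ ⟨φ, hφ, rfl⟩
        exact Submodule.map_le_iff_le_comap.1 (le_sSup ⟨φ, hφ, rfl⟩)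
      · obtain ⟨_, ⟨φ, hφ, rfl⟩, hx'⟩ := (Submodule.mem_sSup_of_directed hc'ne hc'dir).1 hx
        have : x ∈ φ.domain := by
          rw [← (hmap φ hφ).2]
          exact hx'
        exact le_sSup (Set.mem_image_of_mem LinearPMap.domain hφ) this) f₀ hf₀
  obtain ⟨hφf, N, hN, hdom⟩ := hφ.prop
  have htop : N = ⊤ := by
    by_contra hne
    obtain ⟨x, hx⟩ : ∃ x, x ∉ N := by
      by_contra! h
      exact hne (eq_top_iff.2 fun x _ => h x)
    obtain ⟨K, _, hxK, hKpure, hKrel⟩ := (hF.quotient hN).exists_countable_submodule (N.mkQ x)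
    obtain ⟨D, g⟩ := φ
    obtain rfl : D = N.comap p := hdom
    obtain ⟨g', hg'⟩ := exists_extension_comap hp N K (hC K hKrel) g
    have hNK : N.comap p ≤ (K.comap N.mkQ).comap p := fun y hy => by
      have h0 : N.mkQ (p y) = 0 := (Submodule.Quotient.mk_eq_zero N).2 hy
      simp only [Submodule.mem_comap, h0, zero_mem]
    have hlt : (⟨N.comap p, g⟩ : E →ₗ.[S] C) ≤ ⟨(K.comap N.mkQ).comap p, g'⟩ := by
      refine ⟨hNK, ?_⟩
      rintro ⟨y, hy⟩ ⟨z, hz⟩ (rfl : y = z)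
      exact (hg' y hy hz).symm
    obtain ⟨e, rfl⟩ := hp x
    exact hx ((hφ.le_of_ge ⟨hφf.trans hlt, _, hN.comap_mkQ hKpure, rfl⟩ hlt).1
      (show e ∈ (K.comap N.mkQ).comap p from hxK))
  have hall : ∀ x, x ∈ φ.domain := fun x => by simp [hdom, htop]
  refine ⟨φ.toFun.comp (LinearMap.id.codRestrict _ hall), fun x => ?_⟩
  exact (hφf.2 (x := x) (y := ⟨x, hall x⟩) rfl).symm

end Filtration

/-- If `R` is a countable ring and `𝒟` is the class of flat
Mittag-Leffler right `R`-modules, then `𝒟^⊥` is exactly the class of cotorsion modules: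
`Ext¹(D, C) = 0` for all flat Mittag-Leffler `D` iff `Ext¹(F, C) = 0` for all flat `F`. -/
theorem perp_flat_mittagLeffler_eq_cotorsion
    (R : Type u) [Ring R] [Countable R] (C : ModuleCat.{u} Rᵐᵒᵖ) :
    (∀ D : ModuleCat.{u} Rᵐᵒᵖ, IsRightFlat R D → IsMittagLeffler R D →
        Subsingleton (ext1 R D C)) ↔
      (∀ F : ModuleCat.{u} Rᵐᵒᵖ, IsRightFlat R F → Subsingleton (ext1 R F C)) := by
  refine ⟨fun h F hF => ?_, fun h D hD _ => h D hD⟩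
  have : Countable Rᵐᵒᵖ := MulOpposite.opEquiv.symm.countable_iff.2 inferInstance
  rw [subsingleton_ext1_iff]
  refine hF.relationsAreTrivial.kernelMapsExtend fun N _ _ _ hN =>
    kernelMapsExtend_of_countable (fun D _ _ hD => ?_) hN
  exact (subsingleton_ext1_iff (ModuleCat.of Rᵐᵒᵖ D) C).1
    (h _ hD.isRightFlat hD.isMittagLeffler)
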